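/- arXiv:2308.01782 — 2 statements merged into one kernel-verified Lean document; each statement's English description precedes it below -/
import Mathlib

section
/- Let n ≥ 1, R > 0, 1 < p < ∞, a < n, b ≥ 1 and c > 0. Then for every complex-valued function f ∈ C_0^1(B(0,R)\{0}) one has ((n-a)/p)^p · ∫_{B(0,R)} |f(x)|^p / (|x|^a (1-(|x|/R)^c)^{b-1}) dx ≤ ∫_{B(0,R)} |𝓡f(x)|^p / (|x|^{a-p} (1-(|x|/R)^c)^{b-1}) dx. Moreover, the constant ((n-a)/p)^p is sharp: for every ε > 0 there exists a nonzero f ∈ C_0^1(B(0,R)\{0}) for which the right-hand side is finite and strictly less than (((n-a)/p)^p + ε) times the integral on the left-hand side. -/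
open MeasureTheory Metric

/-- The radial derivative `𝓡f(x) = Df(x)[x/|x|]` of a complex-valued function on `ℝⁿ`. -/
noncomputable def radDeriv {n : ℕ} (f : EuclideanSpace ℝ (Fin n) → ℂ)
    (x : EuclideanSpace ℝ (Fin n)) : ℂ :=
  fderiv ℝ f x (‖x‖⁻¹ • x)

/-- The divergence theorem for the vector field `x ↦ H x • x`. -/
lemma integral_mul_add_fderiv_self {n : ℕ} {H : EuclideanSpace ℝ (Fin n) → ℝ}
    (hH : ContDiff ℝ 1 H) (hs : HasCompactSupport H) :
    ∫ x, ((n : ℝ) * H x + fderiv ℝ H x x) = 0 := by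
  have hD : Continuous (fderiv ℝ H) := hH.continuous_fderiv one_ne_zero
  have hHi : Integrable H := hH.continuous.integrable_of_hasCompactSupport hs
  have hDs : HasCompactSupport (fderiv ℝ H) := hs.fderiv ℝ
  have hprod (i : Fin n) :
      Integrable (fun x : EuclideanSpace ℝ (Fin n) =>
        x i * fderiv ℝ H x (EuclideanSpace.single i (1 : ℝ))) := by
    refine Continuous.integrable_of_hasCompactSupport (by fun_prop) ?_
    refine hDs.mono fun x hx => ?_
    contrapose! hx
    simp only [Function.mem_support, not_not] at hx ⊢
    simp [hx]
  have hi (i : Fin n) :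
      ∫ x : EuclideanSpace ℝ (Fin n), x i * fderiv ℝ H x (EuclideanSpace.single i (1 : ℝ)) =
        -∫ x, H x := by
    have hproj (x : EuclideanSpace ℝ (Fin n)) :
        HasFDerivAt (fun x : EuclideanSpace ℝ (Fin n) => x i)
          (EuclideanSpace.proj i : EuclideanSpace ℝ (Fin n) →L[ℝ] ℝ) x :=
      (EuclideanSpace.proj i : EuclideanSpace ℝ (Fin n) →L[ℝ] ℝ).hasFDerivAt
    have hone (x : EuclideanSpace ℝ (Fin n)) :
        fderiv ℝ (fun x : EuclideanSpace ℝ (Fin n) => x i) x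
          (EuclideanSpace.single i (1 : ℝ)) * H x = H x := by
      rw [(hproj x).fderiv]
      simp
    rw [integral_mul_fderiv_eq_neg_fderiv_mul_of_integrable (by simpa only [hone] using hHi)
      (hprod i) ?_ (fun x _ => (hproj x).differentiableAt)
      (fun x _ => hH.differentiable one_ne_zero x)]
    · simp only [hone]
    · refine Continuous.integrable_of_hasCompactSupport ?_ hs.mul_left
      have := hH.continuous
      fun_prop
  have hexp (x : EuclideanSpace ℝ (Fin n)) :
      fderiv ℝ H x x = ∑ i, x i * fderiv ℝ H x (EuclideanSpace.single i (1 : ℝ)) := by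
    generalize fderiv ℝ H x = L
    conv_lhs => rw [← (EuclideanSpace.basisFun (Fin n) ℝ).sum_repr x, map_sum]
    simp
  simp only [hexp]
  rw [integral_add (hHi.const_mul _) (integrable_finsetSum _ fun i _ => hprod i),
    integral_finsetSum _ fun i _ => hprod i, integral_const_mul]
  simp [hi]

/-- The weighted form of Young's inequality behind Hardy's inequality. -/
lemma mul_rpow_sub_one_mul_le {p l s t : ℝ} (hp : 1 < p) (hl : 0 < l) (hs : 0 ≤ s)
    (ht : 0 ≤ t) :
    p * (s ^ (p - 1) * t) ≤ (p - 1) * l * s ^ p + l ^ (1 - p) * t ^ p := by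
  have hp0 : 0 < p := by linarith
  have h := Real.geom_mean_le_arith_mean2_weighted (w₁ := (p - 1) / p) (w₂ := 1 / p)
    (p₁ := (l * s ^ p)) (p₂ := (l ^ (1 - p) * t ^ p)) (by have := sub_pos.2 hp; positivity)
    (by positivity) (by positivity) (by positivity) (by field_simp; ring)
  have e : (l * s ^ p) ^ ((p - 1) / p) * (l ^ (1 - p) * t ^ p) ^ (1 / p) = s ^ (p - 1) * t := by
    rw [Real.mul_rpow hl.le (by positivity), Real.mul_rpow (by positivity) (by positivity),
      ← Real.rpow_mul hs, ← Real.rpow_mul ht, ← Real.rpow_mul hl.le,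
      mul_div_cancel₀ _ hp0.ne', mul_one_div_cancel hp0.ne', Real.rpow_one]
    calc _ = (l ^ ((p - 1) / p) * l ^ ((1 - p) * (1 / p))) * (s ^ (p - 1) * t) := by ring
      _ = _ := by
        rw [← Real.rpow_add hl, show (p - 1) / p + (1 - p) * (1 / p) = 0 by ring]
        simp
  rw [e] at h
  calc _ ≤ p * _ := mul_le_mul_of_nonneg_left h hp0.le
    _ = _ := by field_simp

/-- The radial weight `1 / (r ^ a * (1 - (r / R) ^ c) ^ (b - 1))`. -/
noncomputable def hardyWeight (R a b c r : ℝ) : ℝ :=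
  (r ^ a * (1 - (r / R) ^ c) ^ (b - 1))⁻¹

lemma one_sub_div_rpow_pos {R c r : ℝ} (hc : 0 < c) (hr : 0 < r) (hrR : r < R) :
    0 < 1 - (r / R) ^ c := by
  have hR : 0 < R := hr.trans hrR
  have := Real.rpow_lt_one (by positivity : 0 ≤ r / R) ((div_lt_one hR).2 hrR) hc
  linarith

lemma hardyWeight_pos {R a b c r : ℝ} (hc : 0 < c) (hr : 0 < r) (hrR : r < R) :
    0 < hardyWeight R a b c r := by
  have := one_sub_div_rpow_pos hc hr hrR
  unfold hardyWeight
  positivity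

lemma contDiffAt_hardyWeight {R a b c r : ℝ} (hc : 0 < c) (hr : 0 < r) (hrR : r < R) :
    ContDiffAt ℝ 1 (hardyWeight R a b c) r := by
  have h1 := one_sub_div_rpow_pos hc hr hrR
  have hR : 0 < R := hr.trans hrR
  have h2 : r / R ≠ 0 := by positivity
  unfold hardyWeight
  refine ContDiffAt.inv ?_ (by positivity)
  refine (contDiffAt_id.rpow_const_of_ne hr.ne').mul (ContDiffAt.rpow_const_of_ne ?_ h1.ne')
  exact contDiffAt_const.sub ((contDiffAt_id.div_const R).rpow_const_of_ne h2)

lemma neg_mul_hardyWeight_le_deriv_mul {R a b c r : ℝ} (hb : 1 ≤ b) (hc : 0 < c) (hr : 0 < r)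
    (hrR : r < R) :
    -a * hardyWeight R a b c r ≤ deriv (hardyWeight R a b c) r * r := by
  have h1 := one_sub_div_rpow_pos hc hr hrR
  have hR : 0 < R := hr.trans hrR
  have h2 : r / R ≠ 0 := by positivity
  have hu : HasDerivAt (fun r : ℝ => 1 - (r / R) ^ c) (-(1 / R * c * (r / R) ^ (c - 1))) r :=
    (((hasDerivAt_id r).div_const R).rpow_const (p := c) (Or.inl h2)).const_sub 1
  have hv := hu.rpow_const (p := b - 1) (Or.inl h1.ne')
  have hw := ((Real.hasDerivAt_rpow_const (p := a) (Or.inl hr.ne')).mul hv).inv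
    (by simp only [Pi.mul_apply]; positivity)
  have hd : deriv (hardyWeight R a b c) r = _ := hw.deriv
  rw [hd]
  have e : r ^ a = r ^ (a - 1) * r := by rw [← Real.rpow_add_one hr.ne']; ring_nf
  have hb' : 0 ≤ b - 1 := by linarith
  simp only [hardyWeight, Pi.mul_apply]
  rw [← sub_nonneg]
  have key : 0 ≤ r * r ^ a * (1 / R * c * (r / R) ^ (c - 1) * (b - 1) *
      (1 - (r / R) ^ c) ^ (b - 1 - 1)) / (r ^ a * (1 - (r / R) ^ c) ^ (b - 1)) ^ 2 := by
    positivity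
  refine key.trans_eq ?_
  generalize (1 - (r / R) ^ c) ^ (b - 1 - 1) = A
  have hB : (1 - (r / R) ^ c) ^ (b - 1) ≠ 0 := by positivity
  generalize (1 - (r / R) ^ c) ^ (b - 1) = B at *
  generalize (r / R) ^ (c - 1) = C
  have hD : r ^ (a - 1) ≠ 0 := by positivity
  rw [e]
  generalize r ^ (a - 1) = D at *
  field_simp
  ring

section

variable {n : ℕ} {R p a b c : ℝ} {f : EuclideanSpace ℝ (Fin n) → ℂ}

lemma norm_pos_and_lt {x : EuclideanSpace ℝ (Fin n)}
    (hx : x ∈ ball (0 : EuclideanSpace ℝ (Fin n)) R \ {0}) : 0 < ‖x‖ ∧ ‖x‖ < R :=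
  ⟨norm_pos_iff.2 hx.2, by simpa using hx.1⟩

lemma contDiff_norm_rpow_mul_hardyWeight (hp : 1 < p) (hc : 0 < c) (hf : ContDiff ℝ 1 f)
    (hsub : tsupport f ⊆ ball (0 : EuclideanSpace ℝ (Fin n)) R \ {0}) :
    ContDiff ℝ 1 (fun x => ‖f x‖ ^ p * hardyWeight R a b c ‖x‖) := by
  rw [contDiff_iff_contDiffAt]
  intro x
  by_cases hx : x ∈ tsupport f
  · obtain ⟨h0, hR⟩ := norm_pos_and_lt (hsub hx)
    exact (hf.norm_rpow hp).contDiffAt.mul ((contDiffAt_hardyWeight hc h0 hR).comp x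
      (contDiffAt_norm ℝ (norm_pos_iff.1 h0)))
  · refine (contDiffAt_const (c := (0 : ℝ))).congr_of_eventuallyEq ?_
    filter_upwards [notMem_tsupport_iff_eventuallyEq.1 hx] with y hy
    have : p ≠ 0 := by linarith
    simp [hy, this]

lemma radDeriv_eq_zero_of_notMem_tsupport {x : EuclideanSpace ℝ (Fin n)} (hx : x ∉ tsupport f) :
    radDeriv f x = 0 := by
  simp [radDeriv, fderiv_of_notMem_tsupport ℝ hx]

lemma hasCompactSupport_norm_rpow_mul {g : EuclideanSpace ℝ (Fin n) → ℂ}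
    {w : EuclideanSpace ℝ (Fin n) → ℝ} (hp : 0 < p) (hs : HasCompactSupport f)
    (hg : ∀ x, x ∉ tsupport f → g x = 0) : HasCompactSupport fun x => ‖g x‖ ^ p * w x := by
  refine HasCompactSupport.intro hs fun x hx => ?_
  simp [hg x hx, hp.ne']

lemma continuous_radDeriv_rpow_mul_hardyWeight (hp : 0 < p) (hc : 0 < c) (hf : ContDiff ℝ 1 f)
    (hsub : tsupport f ⊆ ball (0 : EuclideanSpace ℝ (Fin n)) R \ {0}) :
    Continuous (fun x => ‖radDeriv f x‖ ^ p * hardyWeight R a b c ‖x‖) := by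
  rw [continuous_iff_continuousAt]
  intro x
  by_cases hx : x ∈ tsupport f
  · obtain ⟨h0, hR⟩ := norm_pos_and_lt (hsub hx)
    have hD := (hf.continuous_fderiv one_ne_zero).continuousAt (x := x)
    have hv : ContinuousAt (fun x : EuclideanSpace ℝ (Fin n) => ‖x‖⁻¹ • x) x :=
      (continuous_norm.continuousAt.inv₀ h0.ne').smul continuousAt_id
    have hw : ContinuousAt (fun x : EuclideanSpace ℝ (Fin n) => hardyWeight R a b c ‖x‖) x :=
      ContinuousAt.comp (g := hardyWeight R a b c)
        (contDiffAt_hardyWeight hc h0 hR).continuousAt continuous_norm.continuousAt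
    exact ((hD.clm_apply hv).norm.rpow_const (Or.inr hp.le)).mul hw
  · refine (continuousAt_const (y := (0 : ℝ))).congr ?_
    filter_upwards [(isClosed_tsupport f).isOpen_compl.mem_nhds hx] with y hy
    simp [radDeriv_eq_zero_of_notMem_tsupport hy, hp.ne']

lemma integrable_radDeriv_rpow_mul_hardyWeight (hp : 0 < p) (hc : 0 < c) (hf : ContDiff ℝ 1 f)
    (hs : HasCompactSupport f)
    (hsub : tsupport f ⊆ ball (0 : EuclideanSpace ℝ (Fin n)) R \ {0}) :
    Integrable (fun x => ‖radDeriv f x‖ ^ p * hardyWeight R a b c ‖x‖) :=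
  (continuous_radDeriv_rpow_mul_hardyWeight hp hc hf hsub).integrable_of_hasCompactSupport
    (hasCompactSupport_norm_rpow_mul hp hs fun _ => radDeriv_eq_zero_of_notMem_tsupport)

lemma integrable_norm_rpow_mul_hardyWeight (hp : 1 < p) (hc : 0 < c) (hf : ContDiff ℝ 1 f)
    (hs : HasCompactSupport f)
    (hsub : tsupport f ⊆ ball (0 : EuclideanSpace ℝ (Fin n)) R \ {0}) :
    Integrable (fun x => ‖f x‖ ^ p * hardyWeight R a b c ‖x‖) :=
  (contDiff_norm_rpow_mul_hardyWeight hp hc hf hsub).continuous.integrable_of_hasCompactSupport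
    (hasCompactSupport_norm_rpow_mul (by linarith) hs fun _ => image_eq_zero_of_notMem_tsupport)

lemma setIntegral_ball_norm_rpow_mul {g : EuclideanSpace ℝ (Fin n) → ℂ}
    {w : EuclideanSpace ℝ (Fin n) → ℝ} (hp : 0 < p)
    (hsub : tsupport f ⊆ ball (0 : EuclideanSpace ℝ (Fin n)) R \ {0})
    (hg : ∀ x, x ∉ tsupport f → g x = 0) :
    ∫ x in ball (0 : EuclideanSpace ℝ (Fin n)) R, ‖g x‖ ^ p * w x = ∫ x, ‖g x‖ ^ p * w x := by
  refine setIntegral_eq_integral_of_forall_compl_eq_zero fun x hx => ?_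
  simp [hg x fun h => hx (hsub h).1, hp.ne']

lemma hardyWeight_sub {r : ℝ} (hr : 0 < r) :
    hardyWeight R (a - p) b c r = r ^ p * hardyWeight R a b c r := by
  simp only [hardyWeight, Real.rpow_sub hr]
  have : r ^ a ≠ 0 := by positivity
  have : r ^ p ≠ 0 := by positivity
  field_simp

/-- The pointwise estimate whose integral is Hardy's inequality. -/
lemma hardy_pointwise (hp : 1 < p) (ha : a < (n : ℝ)) (hb : 1 ≤ b) (hc : 0 < c)
    (hf : ContDiff ℝ 1 f)
    (hsub : tsupport f ⊆ ball (0 : EuclideanSpace ℝ (Fin n)) R \ {0})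
    (x : EuclideanSpace ℝ (Fin n)) :
    (((n : ℝ) - a) / p) * (‖f x‖ ^ p * hardyWeight R a b c ‖x‖) -
        (((n : ℝ) - a) / p) ^ (1 - p) * (‖radDeriv f x‖ ^ p * hardyWeight R (a - p) b c ‖x‖) ≤
      (n : ℝ) * (‖f x‖ ^ p * hardyWeight R a b c ‖x‖) +
        fderiv ℝ (fun x => ‖f x‖ ^ p * hardyWeight R a b c ‖x‖) x x := by
  have hp0 : p ≠ 0 := by linarith
  by_cases hx : x ∈ tsupport f
  swap
  · have h0 : (fun x => ‖f x‖ ^ p * hardyWeight R a b c ‖x‖) =ᶠ[nhds x] fun _ => 0 := by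
      filter_upwards [notMem_tsupport_iff_eventuallyEq.1 hx] with y hy
      simp [hy, hp0]
    rw [h0.fderiv_eq]
    simp [image_eq_zero_of_notMem_tsupport hx, radDeriv_eq_zero_of_notMem_tsupport hx, hp0]
  obtain ⟨h0, hR⟩ := norm_pos_and_lt (hsub hx)
  have hdiff : DifferentiableAt ℝ (fun x => ‖f x‖ ^ p) x :=
    (hf.norm_rpow hp).differentiable one_ne_zero x
  have hnorm : DifferentiableAt ℝ (fun x : EuclideanSpace ℝ (Fin n) => ‖x‖) x :=
    (contDiffAt_norm ℝ (norm_pos_iff.1 h0)).differentiableAt one_ne_zero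
  have hwd := ((contDiffAt_hardyWeight (a := a) (b := b) hc h0 hR).differentiableAt
    one_ne_zero).hasDerivAt.comp_hasFDerivAt x hnorm.hasFDerivAt
  have hfd := (hdiff.hasFDerivAt.mul hwd).fderiv
  have hrad : fderiv ℝ f x x = (‖x‖ : ℝ) • radDeriv f x := by
    simp [radDeriv, h0.ne']
  have hinner : -(p * (‖f x‖ ^ (p - 1) * (‖x‖ * ‖radDeriv f x‖))) ≤
      fderiv ℝ (fun x => ‖f x‖ ^ p) x x := by
    rw [(hf.differentiable one_ne_zero).fderiv_norm_rpow hp]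
    refine neg_le_of_abs_le ?_
    simp only [smul_apply, ContinuousLinearMap.comp_apply, innerSL_apply_apply,
      smul_eq_mul]
    rw [abs_mul, hrad, abs_of_nonneg (by positivity)]
    calc _ ≤ p * ‖f x‖ ^ (p - 2) * (‖f x‖ * ‖(‖x‖ : ℝ) • radDeriv f x‖) := by
          gcongr
          exact abs_real_inner_le_norm _ _
      _ = p * ((‖f x‖ ^ (p - 2) * ‖f x‖) * (‖x‖ * ‖radDeriv f x‖)) := by
          rw [norm_smul, norm_norm]; ring
      _ = _ := by
          rw [← Real.rpow_add_one' (by positivity) (by linarith)]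
          ring_nf
  have hl : 0 < ((n : ℝ) - a) / p := div_pos (by linarith) (by linarith)
  have hyoung := mul_rpow_sub_one_mul_le (s := ‖f x‖) (t := ‖x‖ * ‖radDeriv f x‖) hp hl
    (by positivity) (by positivity)
  rw [Real.mul_rpow (by positivity) (by positivity)] at hyoung
  have hw := neg_mul_hardyWeight_le_deriv_mul (a := a) hb hc h0 hR
  have hW := hardyWeight_pos (a := a) (b := b) hc h0 hR
  have hF : 0 ≤ ‖f x‖ ^ p := by positivity
  have hfx : fderiv ℝ (fun x => ‖f x‖ ^ p * hardyWeight R a b c ‖x‖) x x =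
      ‖f x‖ ^ p * (deriv (hardyWeight R a b c) ‖x‖ * ‖x‖) +
        hardyWeight R a b c ‖x‖ * fderiv ℝ (fun x => ‖f x‖ ^ p) x x := by
    refine (congrArg (fun L => L x) hfd).trans ?_
    simp [hnorm.fderiv_norm_self]
  rw [hfx, hardyWeight_sub h0]
  have hn : (n : ℝ) = p * (((n : ℝ) - a) / p) + a := by field_simp; ring
  have h1 := mul_le_mul_of_nonneg_left hw hF
  have h2 := mul_le_mul_of_nonneg_left ((neg_le_neg hyoung).trans hinner) hW.le
  generalize ((n : ℝ) - a) / p = l at *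
  rw [hn]
  nlinarith

theorem hardy_inequality (hp : 1 < p) (ha : a < (n : ℝ)) (hb : 1 ≤ b) (hc : 0 < c)
    (hf : ContDiff ℝ 1 f) (hs : HasCompactSupport f)
    (hsub : tsupport f ⊆ ball (0 : EuclideanSpace ℝ (Fin n)) R \ {0}) :
    (((n : ℝ) - a) / p) ^ p * (∫ x, ‖f x‖ ^ p * hardyWeight R a b c ‖x‖) ≤
      ∫ x, ‖radDeriv f x‖ ^ p * hardyWeight R (a - p) b c ‖x‖ := by
  have hl : 0 < ((n : ℝ) - a) / p := div_pos (by linarith) (by linarith)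
  have hI := integrable_norm_rpow_mul_hardyWeight (a := a) (b := b) hp hc hf hs hsub
  have hJ := integrable_radDeriv_rpow_mul_hardyWeight (p := p) (a := a - p) (b := b)
    (by linarith) hc hf hs hsub
  have hH := contDiff_norm_rpow_mul_hardyWeight (a := a) (b := b) hp hc hf hsub
  have hHs : HasCompactSupport (fun x => ‖f x‖ ^ p * hardyWeight R a b c ‖x‖) :=
    hasCompactSupport_norm_rpow_mul (by linarith) hs fun _ => image_eq_zero_of_notMem_tsupport
  have hDi : Integrable fun x => fderiv ℝ (fun x => ‖f x‖ ^ p * hardyWeight R a b c ‖x‖) x x := by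
    have := hH.continuous_fderiv one_ne_zero
    refine Continuous.integrable_of_hasCompactSupport (by fun_prop) ?_
    refine (hHs.fderiv ℝ).mono fun x hx => ?_
    contrapose! hx
    simp only [Function.mem_support, not_not] at hx ⊢
    simp [hx]
  have h := integral_mono ((hI.const_mul _).sub (hJ.const_mul _)) ((hI.const_mul _).add hDi)
    (hardy_pointwise hp ha hb hc hf hsub)
  simp only [Pi.add_apply] at h
  rw [integral_mul_add_fderiv_self hH hHs] at h
  simp only [Pi.sub_apply] at h
  rw [integral_sub (hI.const_mul _) (hJ.const_mul _), integral_const_mul, integral_const_mul,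
    sub_nonpos] at h
  have h' := mul_le_mul_of_nonneg_left h (Real.rpow_nonneg hl.le (p - 1))
  rwa [← mul_assoc, ← mul_assoc, ← Real.rpow_add_one hl.ne', ← Real.rpow_add hl,
    sub_add_cancel, sub_add_sub_cancel, sub_self, Real.rpow_zero, one_mul] at h'

end

/-- Radial integrals against the scale-invariant measure `‖x‖ ^ (-n) dx`. -/
lemma integral_norm_rpow_neg_mul_comp_rpow {n : ℕ} (hn : 1 ≤ n) {R κ : ℝ} (hR : 0 < R)
    (hκ : 0 < κ) (g : ℝ → ℝ) :
    ∫ x : EuclideanSpace ℝ (Fin n), ‖x‖ ^ (-(n : ℝ)) * g ((‖x‖ / R) ^ κ) =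
      n * volume.real (ball (0 : EuclideanSpace ℝ (Fin n)) 1) * κ⁻¹ *
        ∫ y in Set.Ioi (0 : ℝ), y⁻¹ * g y := by
  have : Nonempty (Fin n) := ⟨⟨0, hn⟩⟩
  have hradial : ∫ r in Set.Ioi (0 : ℝ), r ^ (n - 1) • (r ^ (-(n : ℝ)) * g ((r / R) ^ κ)) =
      ∫ r in Set.Ioi (0 : ℝ), R⁻¹ * ((R⁻¹ * r)⁻¹ * g ((R⁻¹ * r) ^ κ)) := by
    refine setIntegral_congr_fun measurableSet_Ioi fun r (hr : 0 < r) => ?_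
    have e : r ^ (n - 1) * r ^ (-(n : ℝ)) = r⁻¹ := by
      rw [← Real.rpow_natCast, ← Real.rpow_add hr, Nat.cast_sub hn, ← Real.rpow_neg_one]
      congr 1
      push_cast
      ring
    simp only [smul_eq_mul]
    rw [← mul_assoc, e, div_eq_inv_mul]
    field_simp
  have hscale : ∫ r in Set.Ioi (0 : ℝ), R⁻¹ * ((R⁻¹ * r)⁻¹ * g ((R⁻¹ * r) ^ κ)) =
      ∫ s in Set.Ioi (0 : ℝ), s⁻¹ * g (s ^ κ) := by
    rw [integral_const_mul, integral_comp_mul_left_Ioi (fun s => s⁻¹ * g (s ^ κ)) 0 (inv_pos.2 hR)]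
    simp [hR.ne']
  have hpow : ∫ s in Set.Ioi (0 : ℝ), s⁻¹ * g (s ^ κ) =
      κ⁻¹ * ∫ y in Set.Ioi (0 : ℝ), y⁻¹ * g y := by
    rw [← integral_comp_rpow_Ioi_of_pos (g := fun y => y⁻¹ * g y) hκ, ← integral_const_mul]
    refine setIntegral_congr_fun measurableSet_Ioi fun s (hs : 0 < s) => ?_
    have hs' : s ^ κ ≠ 0 := by positivity
    simp only [smul_eq_mul, Real.rpow_sub_one hs.ne']
    field_simp
  rw [integral_fun_norm_addHaar volume fun r => r ^ (-(n : ℝ)) * g ((r / R) ^ κ),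
    finrank_euclideanSpace_fin, hradial, hscale, hpow]
  simp [mul_assoc]

/-- The radial profile `r ^ (-l) * ψ ((r / R) ^ κ)`: a dilation in logarithmic scale of a cut-off
of the virtual extremal `r ^ (-l)`. -/
noncomputable def hardyProfile (ψ : ℝ → ℝ) (R l κ r : ℝ) : ℝ :=
  r ^ (-l) * ψ ((r / R) ^ κ)

lemma hasDerivAt_hardyProfile {ψ : ℝ → ℝ} {R l κ r : ℝ} (hψ : ContDiff ℝ 1 ψ) (hR : 0 < R)
    (hr : 0 < r) :
    HasDerivAt (hardyProfile ψ R l κ)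
      (r⁻¹ * (r ^ (-l) * (-l * ψ ((r / R) ^ κ) +
        κ * ((r / R) ^ κ * deriv ψ ((r / R) ^ κ))))) r := by
  have hrR : r / R ≠ 0 := by positivity
  have h1 := ((hasDerivAt_id r).div_const R).rpow_const (p := κ) (Or.inl hrR)
  have h2 := ((hψ.differentiable one_ne_zero ((r / R) ^ κ)).hasDerivAt).comp r h1
  have h3 := (Real.hasDerivAt_rpow_const (p := -l) (Or.inl hr.ne')).mul h2
  refine h3.congr_deriv ?_
  simp only [Function.comp_apply, id_eq, Real.rpow_sub_one hr.ne', Real.rpow_sub_one hrR]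
  field_simp

lemma contDiffAt_hardyProfile {ψ : ℝ → ℝ} {R l κ r : ℝ} (hψ : ContDiff ℝ 1 ψ) (hR : 0 < R)
    (hr : 0 < r) : ContDiffAt ℝ 1 (hardyProfile ψ R l κ) r := by
  have hrR : r / R ≠ 0 := by positivity
  exact (contDiffAt_id.rpow_const_of_ne hr.ne').mul
    (hψ.contDiffAt.comp r ((contDiffAt_id.div_const R).rpow_const_of_ne hrR))

section

variable {n : ℕ} {R κ l : ℝ} {ψ : ℝ → ℝ}

lemma tsupport_hardyProfile_norm_subset (hκ : 0 < κ)
    (hsupp : Function.support ψ ⊆ Set.Icc (1 / 4) (1 / 2)) :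
    tsupport (fun x : EuclideanSpace ℝ (Fin n) => (hardyProfile ψ R l κ ‖x‖ : ℂ)) ⊆
      {x | (‖x‖ / R) ^ κ ∈ Set.Icc (1 / 4) (1 / 2)} := by
  refine closure_minimal (fun x hx => hsupp ?_) ?_
  · contrapose! hx
    simp only [Function.mem_support, not_not] at hx ⊢
    simp [hardyProfile, hx]
  · refine isClosed_Icc.preimage ?_
    exact (continuous_norm.div_const R).rpow_const fun _ => Or.inr hκ.le

lemma mem_ball_diff_of_rpow_mem_Icc (hR : 0 < R) (hκ : 0 < κ) {x : EuclideanSpace ℝ (Fin n)}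
    (hx : (‖x‖ / R) ^ κ ∈ Set.Icc (1 / 4 : ℝ) (1 / 2)) :
    x ∈ ball (0 : EuclideanSpace ℝ (Fin n)) R \ {0} := by
  constructor
  · have : ‖x‖ / R < 1 := by
      by_contra! h
      have := Real.one_le_rpow h hκ.le
      linarith [hx.2]
    simpa using (div_lt_one hR).1 this
  · rintro rfl
    have h := hx.1
    simp only [norm_zero, zero_div, Real.zero_rpow hκ.ne'] at h
    norm_num at h

lemma contDiff_hardyProfile_norm (hψ : ContDiff ℝ 1 ψ) (hR : 0 < R) (hκ : 0 < κ)
    (hsupp : Function.support ψ ⊆ Set.Icc (1 / 4) (1 / 2)) :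
    ContDiff ℝ 1 (fun x : EuclideanSpace ℝ (Fin n) => (hardyProfile ψ R l κ ‖x‖ : ℂ)) := by
  rw [contDiff_iff_contDiffAt]
  intro x
  by_cases hx : x ∈ tsupport fun x : EuclideanSpace ℝ (Fin n) => (hardyProfile ψ R l κ ‖x‖ : ℂ)
  · obtain ⟨h0, -⟩ := norm_pos_and_lt (mem_ball_diff_of_rpow_mem_Icc hR hκ
      (tsupport_hardyProfile_norm_subset hκ hsupp hx))
    exact Complex.ofRealCLM.contDiff.contDiffAt.comp x ((contDiffAt_hardyProfile hψ hR h0).comp x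
      (contDiffAt_norm ℝ (norm_pos_iff.1 h0)))
  · exact contDiffAt_const.congr_of_eventuallyEq (notMem_tsupport_iff_eventuallyEq.1 hx)

lemma norm_radDeriv_hardyProfile_norm (hψ : ContDiff ℝ 1 ψ) (hR : 0 < R)
    {x : EuclideanSpace ℝ (Fin n)} (hx : 0 < ‖x‖) :
    ‖radDeriv (fun x : EuclideanSpace ℝ (Fin n) => (hardyProfile ψ R l κ ‖x‖ : ℂ)) x‖ =
      ‖x‖⁻¹ * (‖x‖ ^ (-l) * |-l * ψ ((‖x‖ / R) ^ κ) +
        κ * ((‖x‖ / R) ^ κ * deriv ψ ((‖x‖ / R) ^ κ))|) := by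
  have hnorm : DifferentiableAt ℝ (fun x : EuclideanSpace ℝ (Fin n) => ‖x‖) x :=
    (contDiffAt_norm ℝ (norm_pos_iff.1 hx)).differentiableAt one_ne_zero
  have h := (hasDerivAt_hardyProfile (l := l) (κ := κ) hψ hR hx).ofReal_comp.hasFDerivAt.comp x
    hnorm.hasFDerivAt
  have e : radDeriv (fun x : EuclideanSpace ℝ (Fin n) => (hardyProfile ψ R l κ ‖x‖ : ℂ)) x =
      ((‖x‖⁻¹ * (‖x‖ ^ (-l) * (-l * ψ ((‖x‖ / R) ^ κ) +
        κ * ((‖x‖ / R) ^ κ * deriv ψ ((‖x‖ / R) ^ κ)))) : ℝ) : ℂ) := by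
    refine (congrArg (fun L => L (‖x‖⁻¹ • x)) h.fderiv).trans ?_
    simp [hnorm.fderiv_norm_self, hx.ne']
  rw [e, Complex.norm_real, Real.norm_eq_abs, abs_mul, abs_mul, abs_of_nonneg (by positivity),
    abs_of_nonneg (by positivity : 0 ≤ ‖x‖ ^ (-l))]

lemma rpow_neg_mul_rpow_mul_hardyWeight {p a b c r A : ℝ} (hp : 0 < p) (hR : 0 < R)
    (hκ : 0 < κ) (hr : 0 < r) (hA : 0 ≤ A) :
    (r ^ (-((n - a) / p)) * A) ^ p * hardyWeight R a b c r =
      r ^ (-(n : ℝ)) * (A ^ p * hardyWeight 1 0 b c (((r / R) ^ κ) ^ κ⁻¹)) := by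
  rw [← Real.rpow_mul (by positivity), mul_inv_cancel₀ hκ.ne', Real.rpow_one,
    Real.mul_rpow (by positivity) hA, ← Real.rpow_mul hr.le]
  have e : r ^ (-((n - a) / p) * p) = r ^ (-(n : ℝ)) * r ^ a := by
    rw [← Real.rpow_add hr]
    congr 1
    field_simp
    ring
  rw [e]
  simp only [hardyWeight, Real.rpow_zero, one_mul, div_one]
  have : r ^ a ≠ 0 := by positivity
  field_simp

/-- The one-dimensional integrand to which the Hardy deficit of `hardyProfile` reduces. -/
noncomputable def hardyDeficit (ψ : ℝ → ℝ) (p l C b c κ y : ℝ) : ℝ :=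
  (|-l * ψ y + κ * (y * deriv ψ y)| ^ p - C * |ψ y| ^ p) * hardyWeight 1 0 b c (y ^ κ⁻¹)

lemma hardyProfile_deficit {p a b c : ℝ} (C : ℝ) (hn : 1 ≤ n) (hp : 0 < p)
    (hψ : ContDiff ℝ 1 ψ) (hR : 0 < R) (hκ : 0 < κ)
    (hsupp : Function.support ψ ⊆ Set.Icc (1 / 4) (1 / 2)) (x : EuclideanSpace ℝ (Fin n)) :
    ‖radDeriv (fun x : EuclideanSpace ℝ (Fin n) =>
          (hardyProfile ψ R ((n - a) / p) κ ‖x‖ : ℂ)) x‖ ^ p * hardyWeight R (a - p) b c ‖x‖ -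
        C * (‖(hardyProfile ψ R ((n - a) / p) κ ‖x‖ : ℂ)‖ ^ p * hardyWeight R a b c ‖x‖) =
      ‖x‖ ^ (-(n : ℝ)) * hardyDeficit ψ p ((n - a) / p) C b c κ ((‖x‖ / R) ^ κ) := by
  rcases eq_or_ne x 0 with rfl | hx
  · have h0 : ψ 0 = 0 := by
      by_contra h
      have := (hsupp h).1
      norm_num at this
    have hn' : -(n : ℝ) ≠ 0 := by simp; lia
    simp [radDeriv, hardyProfile, hp.ne', hκ.ne', h0, Real.zero_rpow hn']
  · have hx := norm_pos_iff.2 hx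
    rw [norm_radDeriv_hardyProfile_norm hψ hR hx, hardyWeight_sub hx,
      Real.mul_rpow (by positivity) (by positivity), Real.inv_rpow hx.le, Complex.norm_real,
      Real.norm_eq_abs]
    have h1 := rpow_neg_mul_rpow_mul_hardyWeight (n := n) (a := a) (b := b) (c := c) hp hR hκ hx
      (abs_nonneg (-((n - a) / p) * ψ ((‖x‖ / R) ^ κ) +
        κ * ((‖x‖ / R) ^ κ * deriv ψ ((‖x‖ / R) ^ κ))))
    have h2 := rpow_neg_mul_rpow_mul_hardyWeight (n := n) (a := a) (b := b) (c := c) hp hR hκ hx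
      (abs_nonneg (ψ ((‖x‖ / R) ^ κ)))
    have e : |hardyProfile ψ R ((n - a) / p) κ ‖x‖| =
        ‖x‖ ^ (-((n - a) / p)) * |ψ ((‖x‖ / R) ^ κ)| := by
      rw [hardyProfile, abs_mul, abs_of_nonneg (by positivity)]
    rw [e, h2, hardyDeficit, sub_mul, mul_sub]
    have hne : ‖x‖ ^ p ≠ 0 := by positivity
    rw [← h1]
    field_simp

end

lemma hardyWeight_one_zero_le {b c s t : ℝ} (hb : 1 ≤ b) (hc : 0 < c) (hs : 0 ≤ s) (hst : s ≤ t)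
    (ht0 : 0 < t) (ht : t < 1) : hardyWeight 1 0 b c s ≤ hardyWeight 1 0 b c t := by
  have h := one_sub_div_rpow_pos hc ht0 ht
  have hb' : 0 ≤ b - 1 := by linarith
  simp only [hardyWeight, Real.rpow_zero, one_mul, div_one] at *
  gcongr

lemma hardyWeight_one_zero_nonneg {b c s : ℝ} (hc : 0 < c) (hs : 0 ≤ s) (hs1 : s ≤ 1) :
    0 ≤ hardyWeight 1 0 b c s := by
  have := Real.rpow_le_one hs hs1 hc.le
  have : 0 ≤ 1 - s ^ c := by linarith
  simp only [hardyWeight, Real.rpow_zero, one_mul, div_one]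
  positivity

lemma tendsto_hardyWeight_one_zero {b c : ℝ} (hc : 0 < c) :
    Filter.Tendsto (hardyWeight 1 0 b c) (nhds 0) (nhds 1) := by
  have h : ContinuousAt (fun s : ℝ => ((1 - s ^ c) ^ (b - 1))⁻¹) 0 := by
    refine ContinuousAt.inv₀ (ContinuousAt.rpow_const ?_ ?_) ?_
    · exact continuousAt_const.sub (continuousAt_id.rpow_const (Or.inr hc.le))
    · simp [hc.ne']
    · simp [hc.ne']
  have h' : hardyWeight 1 0 b c = fun s : ℝ => ((1 - s ^ c) ^ (b - 1))⁻¹ := by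
    ext s
    simp [hardyWeight]
  simpa [h', ContinuousAt, hc.ne'] using h.tendsto

lemma tendsto_integral_hardyDeficit {ψ : ℝ → ℝ} {p l C b c : ℝ} (hp : 0 < p) (hb : 1 ≤ b)
    (hc : 0 < c) (hl : 0 < l) (hC : 0 ≤ C) (hψ : ContDiff ℝ 1 ψ) :
    Filter.Tendsto
      (fun k : ℕ => ∫ y in Set.Icc (1 / 4 : ℝ) (1 / 2),
        y⁻¹ * hardyDeficit ψ p l C b c ((k + 1 : ℝ)⁻¹) y)
      Filter.atTop
      (nhds (∫ y in Set.Icc (1 / 4 : ℝ) (1 / 2), y⁻¹ * ((l ^ p - C) * |ψ y| ^ p))) := by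
  have hD : Continuous (deriv ψ) := hψ.continuous_deriv le_rfl
  have hψc := hψ.continuous
  obtain ⟨A, hA⟩ := (isCompact_Icc (a := (1 / 4 : ℝ)) (b := 1 / 2)).exists_bound_of_continuousOn
    hψc.continuousOn
  obtain ⟨B, hB⟩ := (isCompact_Icc (a := (1 / 4 : ℝ)) (b := 1 / 2)).exists_bound_of_continuousOn
    hD.continuousOn
  simp only [Real.norm_eq_abs] at hA hB
  refine tendsto_integral_of_dominated_convergence
    (fun _ => 4 * (((l * A + B) ^ p + C * A ^ p) * hardyWeight 1 0 b c (1 / 2))) (fun k => ?_)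
    (integrable_const _) (fun k => ?_) ?_
  · have : Measurable (hardyWeight 1 0 b c) := by unfold hardyWeight; fun_prop
    unfold hardyDeficit
    exact Measurable.aestronglyMeasurable (by fun_prop)
  · filter_upwards [ae_restrict_mem measurableSet_Icc] with y hy
    have hy0 : 0 < y := by linarith [hy.1]
    have hy1 : y ≤ 1 := by linarith [hy.2]
    have hk : 1 ≤ (k + 1 : ℝ) := by linarith [(Nat.cast_nonneg k : (0 : ℝ) ≤ k)]
    have hκ : (k + 1 : ℝ)⁻¹ ≤ 1 := inv_le_one_of_one_le₀ hk
    have hy2 : y ^ (k + 1 : ℝ) ≤ 1 / 2 :=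
      (Real.rpow_le_self_of_le_one hy0.le hy1 hk).trans hy.2
    have hW := hardyWeight_one_zero_le hb hc (Real.rpow_nonneg hy0.le (k + 1 : ℝ)) hy2
      (by norm_num) (by norm_num)
    have hW0 : 0 ≤ hardyWeight 1 0 b c (y ^ (k + 1 : ℝ)) :=
      hardyWeight_one_zero_nonneg hc (by positivity) (by linarith)
    have h1 : |-l * ψ y + (k + 1 : ℝ)⁻¹ * (y * deriv ψ y)| ≤ l * A + B := by
      refine (abs_add_le _ _).trans (add_le_add ?_ ?_)
      · rw [abs_mul, abs_neg, abs_of_pos hl]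
        exact mul_le_mul_of_nonneg_left (hA y hy) hl.le
      · rw [abs_mul, abs_mul, abs_of_pos hy0, abs_of_pos (by positivity)]
        calc _ ≤ 1 * (1 * |deriv ψ y|) := by gcongr
          _ ≤ B := by simpa using hB y hy
    have h2 : |(|-l * ψ y + (k + 1 : ℝ)⁻¹ * (y * deriv ψ y)| ^ p - C * |ψ y| ^ p)| ≤
        (l * A + B) ^ p + C * A ^ p := by
      refine (abs_sub _ _).trans ?_
      rw [abs_of_nonneg (Real.rpow_nonneg (abs_nonneg _) p),
        abs_of_nonneg (mul_nonneg hC (Real.rpow_nonneg (abs_nonneg _) p))]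
      gcongr
      exact hA y hy
    have h3 : y⁻¹ ≤ 4 := by
      rw [inv_le_comm₀ hy0 (by norm_num)]
      linarith [hy.1]
    rw [hardyDeficit, inv_inv, norm_mul, norm_mul, Real.norm_of_nonneg (by positivity : 0 ≤ y⁻¹),
      Real.norm_eq_abs, Real.norm_of_nonneg hW0]
    have : 0 ≤ (l * A + B) ^ p + C * A ^ p := (abs_nonneg _).trans h2
    gcongr
  · filter_upwards [ae_restrict_mem measurableSet_Icc] with y hy
    have hy0 : 0 < y := by linarith [hy.1]
    have hy1 : y < 1 := by linarith [hy.2]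
    have hκ : Filter.Tendsto (fun k : ℕ => (k + 1 : ℝ)⁻¹) Filter.atTop (nhds 0) := by
      simpa using tendsto_one_div_add_atTop_nhds_zero_nat (𝕜 := ℝ)
    have hw : Filter.Tendsto (fun k : ℕ => hardyWeight 1 0 b c (y ^ ((k + 1 : ℝ)⁻¹)⁻¹))
        Filter.atTop (nhds 1) := by
      refine (tendsto_hardyWeight_one_zero hc).comp ?_
      have := (tendsto_pow_atTop_nhds_zero_of_lt_one hy0.le hy1).comp
        (Filter.tendsto_add_atTop_nat 1)
      refine this.congr fun k => ?_
      rw [inv_inv, ← Nat.cast_succ, Real.rpow_natCast]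
      rfl
    have hin : Filter.Tendsto
        (fun k : ℕ => |-l * ψ y + (k + 1 : ℝ)⁻¹ * (y * deriv ψ y)| ^ p) Filter.atTop
        (nhds (|-l * ψ y + 0 * (y * deriv ψ y)| ^ p)) :=
      ((hκ.mul_const _).const_add _).abs.rpow_const (Or.inr hp.le)
    have := ((hin.sub_const (C * |ψ y| ^ p)).mul hw).const_mul y⁻¹
    refine this.congr' (.of_forall fun k => rfl) |>.trans_eq ?_
    rw [zero_mul, add_zero, abs_mul, abs_neg, abs_of_pos hl, Real.mul_rpow hl.le (abs_nonneg _)]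
    congr 1
    ring

theorem exists_hardy_lt {n : ℕ} (hn : 1 ≤ n) {R p a b c ε : ℝ} (hR : 0 < R) (hp : 1 < p)
    (ha : a < (n : ℝ)) (hb : 1 ≤ b) (hc : 0 < c) (hε : 0 < ε) :
    ∃ f : EuclideanSpace ℝ (Fin n) → ℂ,
      ContDiff ℝ 1 f ∧ HasCompactSupport f ∧
      tsupport f ⊆ ball (0 : EuclideanSpace ℝ (Fin n)) R \ {0} ∧
      ∫ x, ‖radDeriv f x‖ ^ p * hardyWeight R (a - p) b c ‖x‖ <
        ((((n : ℝ) - a) / p) ^ p + ε) * ∫ x, ‖f x‖ ^ p * hardyWeight R a b c ‖x‖ := by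
  have hp0 : 0 < p := by linarith
  have hl : 0 < ((n : ℝ) - a) / p := div_pos (by linarith) hp0
  set C : ℝ := (((n : ℝ) - a) / p) ^ p + ε
  let ψ : ContDiffBump (3 / 8 : ℝ) := ⟨1 / 16, 1 / 8, by norm_num, by norm_num⟩
  have hψ : ContDiff ℝ 1 ψ := ψ.contDiff
  have hball : ball (3 / 8 : ℝ) (1 / 8) ⊆ Set.Icc (1 / 4) (1 / 2) := by
    rw [Real.ball_eq_Ioo]
    refine Set.Ioo_subset_Icc_self.trans (Set.Icc_subset_Icc ?_ ?_) <;> norm_num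
  have hsupp : Function.support ψ ⊆ Set.Icc (1 / 4) (1 / 2) := by
    rw [ψ.support_eq]
    exact hball
  have htsupp : tsupport ψ ⊆ Set.Icc (1 / 4) (1 / 2) := closure_minimal hsupp isClosed_Icc
  have hpos : 0 < ∫ y in Set.Icc (1 / 4 : ℝ) (1 / 2), y⁻¹ * |ψ y| ^ p := by
    rw [setIntegral_pos_iff_support_of_nonneg_ae]
    · refine (measure_ball_pos volume (3 / 8 : ℝ) (by norm_num : (0 : ℝ) < 1 / 8)).trans_le
        (measure_mono fun y hy => ⟨?_, hball hy⟩)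
      have h1 : ψ y ≠ 0 := by
        rw [← Function.mem_support, ψ.support_eq]
        exact hy
      have h2 : 0 < y := by linarith [(hball hy).1]
      have h3 : 0 < |ψ y| := abs_pos.2 h1
      exact (by positivity : 0 < y⁻¹ * |ψ y| ^ p).ne'
    · filter_upwards [ae_restrict_mem measurableSet_Icc] with y hy
      have : 0 < y := by linarith [hy.1]
      simp only [Pi.zero_apply]
      positivity
    · refine ContinuousOn.integrableOn_compact isCompact_Icc (ContinuousOn.mul ?_ ?_)
      · exact continuousOn_id.inv₀ fun y hy => by simp only [id]; linarith [hy.1]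
      · exact (ψ.continuous.abs.rpow_const fun _ => Or.inr hp0.le).continuousOn
  have hlim := tendsto_integral_hardyDeficit (p := p) (C := C) hp0 hb hc hl (by positivity) hψ
  have hneg : ∫ y in Set.Icc (1 / 4 : ℝ) (1 / 2),
      y⁻¹ * (((((n : ℝ) - a) / p) ^ p - C) * |ψ y| ^ p) < 0 := by
    have e (y : ℝ) : y⁻¹ * (((((n : ℝ) - a) / p) ^ p - C) * |ψ y| ^ p) =
        -ε * (y⁻¹ * |ψ y| ^ p) := by
      simp only [C]
      ring
    simp only [e]
    rw [integral_const_mul]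
    nlinarith
  obtain ⟨k, hk⟩ := (hlim.eventually_lt_const hneg).exists
  have hκ : 0 < (k + 1 : ℝ)⁻¹ := by positivity
  have hts := tsupport_hardyProfile_norm_subset (R := R) (n := n) (l := ((n : ℝ) - a) / p) hκ hsupp
  have hsub := hts.trans fun x => mem_ball_diff_of_rpow_mem_Icc hR hκ
  have hf := contDiff_hardyProfile_norm (n := n) (l := ((n : ℝ) - a) / p) hψ hR hκ hsupp
  have hcs : HasCompactSupport fun x : EuclideanSpace ℝ (Fin n) =>
      (hardyProfile ψ R (((n : ℝ) - a) / p) (k + 1 : ℝ)⁻¹ ‖x‖ : ℂ) :=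
    isCompact_of_isClosed_isBounded (isClosed_tsupport _)
      (isBounded_ball.subset (hsub.trans Set.sdiff_subset))
  refine ⟨_, hf, hcs, hsub, ?_⟩
  rw [← sub_neg, ← integral_const_mul, ← integral_sub
    (integrable_radDeriv_rpow_mul_hardyWeight hp0 hc hf hcs hsub)
    ((integrable_norm_rpow_mul_hardyWeight hp hc hf hcs hsub).const_mul _)]
  simp only [hardyProfile_deficit C hn hp0 hψ hR hκ hsupp]
  rw [integral_norm_rpow_neg_mul_comp_rpow hn hR hκ]
  have hIcc : ∫ y in Set.Ioi (0 : ℝ), y⁻¹ *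
      hardyDeficit ψ p (((n : ℝ) - a) / p) C b c (k + 1 : ℝ)⁻¹ y =
      ∫ y in Set.Icc (1 / 4 : ℝ) (1 / 2), y⁻¹ *
        hardyDeficit ψ p (((n : ℝ) - a) / p) C b c (k + 1 : ℝ)⁻¹ y := by
    refine setIntegral_eq_of_subset_of_forall_sdiff_eq_zero measurableSet_Ioi
      (fun y hy => Set.mem_Ioi.2 (by linarith [hy.1])) fun y hy => ?_
    have h1 : y ∉ tsupport ψ := fun h => hy.2 (htsupp h)
    have h2 : deriv ψ y = 0 := by
      rw [(notMem_tsupport_iff_eventuallyEq.1 h1).deriv_eq]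
      simp
    simp [hardyDeficit, image_eq_zero_of_notMem_tsupport h1, h2, hp0.ne']
  rw [hIcc]
  have hn' : 0 < (n : ℝ) := by exact_mod_cast hn
  have hvol : 0 < volume.real (ball (0 : EuclideanSpace ℝ (Fin n)) 1) :=
    ENNReal.toReal_pos (measure_ball_pos _ _ one_pos).ne' measure_ball_lt_top.ne
  exact mul_neg_of_pos_of_neg (by positivity) hk

theorem unified_hardy_interior_singularity {n : ℕ} (hn : 1 ≤ n) {R : ℝ} (hR : 0 < R)
    {p a b c : ℝ} (hp : 1 < p) (ha : a < (n : ℝ)) (hb : 1 ≤ b) (hc : 0 < c) :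
    (∀ f : EuclideanSpace ℝ (Fin n) → ℂ,
      ContDiff ℝ 1 f → HasCompactSupport f →
      tsupport f ⊆ ball (0 : EuclideanSpace ℝ (Fin n)) R \ {0} →
      (((n : ℝ) - a) / p) ^ p *
        (∫ x in ball (0 : EuclideanSpace ℝ (Fin n)) R,
          ‖f x‖ ^ p / (‖x‖ ^ a * (1 - (‖x‖ / R) ^ c) ^ (b - 1))) ≤
      ∫ x in ball (0 : EuclideanSpace ℝ (Fin n)) R,
          ‖radDeriv f x‖ ^ p / (‖x‖ ^ (a - p) * (1 - (‖x‖ / R) ^ c) ^ (b - 1))) ∧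
    (∀ ε : ℝ, 0 < ε →
      ∃ f : EuclideanSpace ℝ (Fin n) → ℂ,
        ContDiff ℝ 1 f ∧ HasCompactSupport f ∧
        tsupport f ⊆ ball (0 : EuclideanSpace ℝ (Fin n)) R \ {0} ∧ f ≠ 0 ∧
        IntegrableOn (fun x =>
          ‖radDeriv f x‖ ^ p / (‖x‖ ^ (a - p) * (1 - (‖x‖ / R) ^ c) ^ (b - 1)))
          (ball (0 : EuclideanSpace ℝ (Fin n)) R) ∧
        (∫ x in ball (0 : EuclideanSpace ℝ (Fin n)) R,
            ‖radDeriv f x‖ ^ p / (‖x‖ ^ (a - p) * (1 - (‖x‖ / R) ^ c) ^ (b - 1))) <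
          ((((n : ℝ) - a) / p) ^ p + ε) *
            ∫ x in ball (0 : EuclideanSpace ℝ (Fin n)) R,
              ‖f x‖ ^ p / (‖x‖ ^ a * (1 - (‖x‖ / R) ^ c) ^ (b - 1))) := by
  have hp0 : 0 < p := by linarith
  have hw (q t d : ℝ) : t / (d ^ q * (1 - (d / R) ^ c) ^ (b - 1)) = t * hardyWeight R q b c d :=
    div_eq_mul_inv _ _
  simp only [hw]
  constructor
  · intro f hf hs hsub
    rw [setIntegral_ball_norm_rpow_mul hp0 hsub fun _ => image_eq_zero_of_notMem_tsupport,
      setIntegral_ball_norm_rpow_mul hp0 hsub fun _ => radDeriv_eq_zero_of_notMem_tsupport]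
    exact hardy_inequality hp ha hb hc hf hs hsub
  · intro ε hε
    obtain ⟨f, hf, hs, hsub, hlt⟩ := exists_hardy_lt hn hR hp ha hb hc hε
    refine ⟨f, hf, hs, hsub, ?_,
      (integrable_radDeriv_rpow_mul_hardyWeight hp0 hc hf hs hsub).integrableOn, ?_⟩
    · rintro rfl
      have hzero (x : EuclideanSpace ℝ (Fin n)) : radDeriv 0 x = 0 :=
        radDeriv_eq_zero_of_notMem_tsupport (by simp)
      simp [hzero, hp0.ne'] at hlt
    · rwa [setIntegral_ball_norm_rpow_mul hp0 hsub fun _ => radDeriv_eq_zero_of_notMem_tsupport,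
        setIntegral_ball_norm_rpow_mul hp0 hsub fun _ => image_eq_zero_of_notMem_tsupport]
end

section
/- Let n ≥ 1, R > 0, 1 ≤ p < ∞ and a ∈ ℝ. Then for every complex-valued function f ∈ C_0^2(B(0,R)\{0}) one has |(n(p-1)+a-p)/p|^p · ∫_{B(0,R)} |𝓡f(x)|^p / |x|^a dx ≤ ∫_{B(0,R)} |𝓡²f(x) + ((n-1)/|x|)·𝓡f(x)|^p / |x|^{a-p} dx. -/
open MeasureTheory Metric

open Filter Topology

/-- Euler's identity in integrated form: the divergence of `F(x) x` integrates to zero. -/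
theorem integral_fderiv_apply_self {n : ℕ} {F : EuclideanSpace ℝ (Fin n) → ℝ}
    (hF : ContDiff ℝ 1 F) (hc : HasCompactSupport F) :
    ∫ x, fderiv ℝ F x x = -(n : ℝ) * ∫ x, F x := by
  have hcont : Continuous (fderiv ℝ F) := hF.continuous_fderiv one_ne_zero
  have hInt (i : Fin n) :
      Integrable fun x : EuclideanSpace ℝ (Fin n) =>
        x i * fderiv ℝ F x (EuclideanSpace.single i 1) :=
    Continuous.integrable_of_hasCompactSupport (by fun_prop)
      ((hc.fderiv_apply ℝ _).mul_left)
  have hparts (i : Fin n) :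
      ∫ x : EuclideanSpace ℝ (Fin n), x i * fderiv ℝ F x (EuclideanSpace.single i 1) =
        -∫ x, F x := by
    have hd (x : EuclideanSpace ℝ (Fin n)) :
        fderiv ℝ (fun y : EuclideanSpace ℝ (Fin n) => y i) x (EuclideanSpace.single i 1) = 1 := by
      have : HasFDerivAt (fun y : EuclideanSpace ℝ (Fin n) => y i)
        (EuclideanSpace.proj (𝕜 := ℝ) i : EuclideanSpace ℝ (Fin n) →L[ℝ] ℝ) x :=
        (EuclideanSpace.proj (𝕜 := ℝ) i : EuclideanSpace ℝ (Fin n) →L[ℝ] ℝ).hasFDerivAt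
      rw [this.fderiv]
      simp
    rw [integral_mul_fderiv_eq_neg_fderiv_mul_of_integrable
      (f := fun y : EuclideanSpace ℝ (Fin n) => y i) (g := F)]
    · simp [hd]
    · simpa [hd] using hF.continuous.integrable_of_hasCompactSupport hc
    · exact hInt i
    · exact Continuous.integrable_of_hasCompactSupport
        ((by fun_prop : Continuous fun y : EuclideanSpace ℝ (Fin n) => y i).mul hF.continuous)
        hc.mul_left
    · intro x _
      fun_prop
    · intro x _
      exact hF.differentiable one_ne_zero x
  have hsum (x : EuclideanSpace ℝ (Fin n)) :
      fderiv ℝ F x x = ∑ i, x i * fderiv ℝ F x (EuclideanSpace.single i 1) := by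
    have h := congrArg (fderiv ℝ F x) ((EuclideanSpace.basisFun (Fin n) ℝ).sum_repr x)
    simpa [map_sum] using h.symm
  simp_rw [hsum]
  rw [integral_finsetSum _ fun i _ => hInt i]
  simp [hparts]

theorem contDiff_mul_norm_rpow {E : Type*} [NormedAddCommGroup E] [InnerProductSpace ℝ E]
    {m : WithTop ℕ∞} {φ : E → ℝ} (hφ : ContDiff ℝ m φ) (h0 : (0 : E) ∉ tsupport φ) (b : ℝ) :
    ContDiff ℝ m fun x => φ x * ‖x‖ ^ b := by
  refine contDiff_iff_contDiffAt.mpr fun x => ?_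
  by_cases hx : x ∈ tsupport φ
  swap
  · refine contDiffAt_const (c := 0) |>.congr_of_eventuallyEq ?_
    filter_upwards [(notMem_tsupport_iff_eventuallyEq.mp hx)] with y hy
    simp [hy]
  have hx0 : x ≠ 0 := by
    rintro rfl
    exact h0 hx
  exact hφ.contDiffAt.mul
    ((contDiffAt_norm ℝ hx0).rpow_const_of_ne (norm_ne_zero_iff.mpr hx0))

theorem tsupport_norm_rpow_subset {X G : Type*} [TopologicalSpace X] [NormedAddCommGroup G]
    (u : X → G) {p : ℝ} (hp : 0 < p) : tsupport (fun x => ‖u x‖ ^ p) ⊆ tsupport u :=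
  tsupport_comp_subset (g := fun v : G => ‖v‖ ^ p) (by simp [hp.ne']) u

theorem integrable_norm_rpow_mul_norm_rpow {n : ℕ} {G : Type*} [NormedAddCommGroup G]
    {k : EuclideanSpace ℝ (Fin n) → G} (hk : Continuous k) (hc : HasCompactSupport k)
    (h0 : (0 : EuclideanSpace ℝ (Fin n)) ∉ tsupport k) {p : ℝ} (hp : 0 < p) (b : ℝ) :
    Integrable fun x => ‖k x‖ ^ p * ‖x‖ ^ b := by
  refine Continuous.integrable_of_hasCompactSupport (contDiff_zero (𝕜 := ℝ).mp
    (contDiff_mul_norm_rpow (contDiff_zero.mpr ?_)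
      (fun h => h0 (tsupport_norm_rpow_subset k hp h)) _)) ?_
  · exact hk.norm.rpow_const fun _ => Or.inr hp.le
  · exact (hc.comp_left (g := fun v : G => ‖v‖ ^ p) (by simp [hp.ne'])).mul_right

theorem tendsto_integral_norm_rpow_mul_norm_rpow {n : ℕ} {G : Type*} [NormedAddCommGroup G]
    {k : EuclideanSpace ℝ (Fin n) → G} (hk : Continuous k) (hc : HasCompactSupport k)
    (h0 : (0 : EuclideanSpace ℝ (Fin n)) ∉ tsupport k) (b : ℝ) :
    Tendsto (fun p : ℝ => ∫ x, ‖k x‖ ^ p * ‖x‖ ^ b) (𝓝[>] 1)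
      (𝓝 (∫ x, ‖k x‖ ^ (1 : ℝ) * ‖x‖ ^ b)) := by
  have hInt {p : ℝ} (hp : 0 < p) := integrable_norm_rpow_mul_norm_rpow hk hc h0 hp b
  have hev : ∀ᶠ p : ℝ in 𝓝[>] 1, p ∈ Set.Ioo (1 : ℝ) 2 := Ioo_mem_nhdsGT one_lt_two
  refine tendsto_integral_filter_of_dominated_convergence
    (fun x => ‖k x‖ ^ (1 : ℝ) * ‖x‖ ^ b + ‖k x‖ ^ (2 : ℝ) * ‖x‖ ^ b) ?_ ?_
    ((hInt one_pos).add (hInt two_pos)) (.of_forall fun x => ?_)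
  · filter_upwards [hev] with p hp
    exact (hInt (one_pos.trans hp.1)).aestronglyMeasurable
  · filter_upwards [hev] with p hp
    refine .of_forall fun x => ?_
    rw [Real.norm_of_nonneg (by positivity), ← add_mul]
    gcongr
    rcases le_total ‖k x‖ 1 with h | h
    · exact (Real.rpow_le_rpow_of_exponent_ge' (norm_nonneg _) h zero_le_one hp.1.le).trans
        (le_add_of_nonneg_right (by positivity))
    · exact (Real.rpow_le_rpow_of_exponent_le h hp.2.le).trans
        (le_add_of_nonneg_left (by positivity))
  · refine Tendsto.mul_const _ (Tendsto.mono_left ?_ nhdsWithin_le_nhds)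
    exact tendsto_const_nhds.rpow tendsto_id (Or.inr one_pos)

section RadialField

variable {E G : Type*} [NormedAddCommGroup E] [NormedSpace ℝ E] [NormedAddCommGroup G]
  [NormedSpace ℝ G]

theorem tsupport_fderiv_apply_self_add_smul_subset (g : E → G) (r : ℝ) :
    tsupport (fun x => fderiv ℝ g x x + r • g x) ⊆ tsupport g := by
  refine closure_minimal (fun x hx => ?_) isClosed_closure
  by_contra hxg
  have h1 : fderiv ℝ g x = 0 := by
    by_contra h
    exact hxg (support_fderiv_subset ℝ h)
  exact hx (by simp [h1, image_eq_zero_of_notMem_tsupport hxg])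

theorem continuous_fderiv_apply_self_add_smul {g : E → G} (hg : ContDiff ℝ 1 g) (r : ℝ) :
    Continuous fun x => fderiv ℝ g x x + r • g x := by
  have := hg.continuous_fderiv one_ne_zero
  have := hg.continuous
  fun_prop

end RadialField

theorem young_rpow_sub_one {A B p : ℝ} (hA : 0 ≤ A) (hB : 0 ≤ B) (hp : 1 < p) :
    p * (A ^ (p - 1) * B) ≤ (p - 1) * A ^ p + B ^ p := by
  have hp0 : 0 < p := by linarith
  have hpq : p.HolderConjugate (p / (p - 1)) := Real.HolderConjugate.conjExponent hp
  have h := Real.young_inequality_of_nonneg hB (Real.rpow_nonneg hA (p - 1)) hpq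
  rw [← Real.rpow_mul hA, mul_div_cancel₀ _ (by linarith : p - 1 ≠ 0)] at h
  have h2 := mul_le_mul_of_nonneg_left h hp0.le
  have h3 : p * (B ^ p / p + A ^ p / (p / (p - 1))) = (p - 1) * A ^ p + B ^ p := by
    field_simp
    ring
  linarith

theorem fderiv_norm_rpow_mul_apply_self {E G : Type*} [NormedAddCommGroup E]
    [InnerProductSpace ℝ E] [NormedAddCommGroup G] [InnerProductSpace ℝ G]
    {g : E → G} {x : E} (hg : DifferentiableAt ℝ g x) (hx : x ≠ 0) {p : ℝ} (hp : 1 < p) (b : ℝ) :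
    fderiv ℝ (fun y => ‖g y‖ ^ p * ‖y‖ ^ b) x x =
      p * ‖g x‖ ^ (p - 2) * inner ℝ (g x) (fderiv ℝ g x x) * ‖x‖ ^ b +
        b * (‖g x‖ ^ p * ‖x‖ ^ b) := by
  have hx' : ‖x‖ ≠ 0 := norm_ne_zero_iff.mpr hx
  have hn : DifferentiableAt ℝ (fun y : E => ‖y‖) x :=
    (contDiffAt_norm ℝ hx).differentiableAt one_ne_zero
  have h1 := (hasFDerivAt_norm_rpow (g x) hp).comp x hg.hasFDerivAt
  have h2 := hn.hasFDerivAt.rpow_const (p := b) (Or.inl hx')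
  have h3 := (h1.mul h2).fderiv
  have h4 : fderiv ℝ (fun y => ‖g y‖ ^ p * ‖y‖ ^ b) x x = _ := congrArg (fun L => L x) h3
  rw [h4]
  have h5 : ‖x‖ ^ b = ‖x‖ ^ (b - 1) * ‖x‖ := by
    rw [Real.rpow_sub_one hx', div_mul_cancel₀ _ hx']
  simp [hn.fderiv_norm_self, h5]
  ring

theorem abs_rpow_mul_integral_norm_rpow_le_of_one_lt {n : ℕ} {G : Type*} [NormedAddCommGroup G]
    [InnerProductSpace ℝ G] {g : EuclideanSpace ℝ (Fin n) → G} (hg : ContDiff ℝ 1 g)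
    (hc : HasCompactSupport g) (h0 : (0 : EuclideanSpace ℝ (Fin n)) ∉ tsupport g)
    {p : ℝ} (hp : 1 < p) (a : ℝ) :
    |((n : ℝ) * (p - 1) + a - p) / p| ^ p * (∫ x, ‖g x‖ ^ p * ‖x‖ ^ (-a)) ≤
      ∫ x, ‖fderiv ℝ g x x + ((n : ℝ) - 1) • g x‖ ^ p * ‖x‖ ^ (-a) := by
  have hp0 : 0 < p := by linarith
  set c := |((n : ℝ) * (p - 1) + a - p) / p| with hcdef
  have hc0 : 0 ≤ c := abs_nonneg _
  set F : EuclideanSpace ℝ (Fin n) → ℝ := fun x => ‖g x‖ ^ p * ‖x‖ ^ (-a) with hFdef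
  set k : EuclideanSpace ℝ (Fin n) → G := fun x => fderiv ℝ g x x + ((n : ℝ) - 1) • g x with hk
  have hksupp : tsupport k ⊆ tsupport g := tsupport_fderiv_apply_self_add_smul_subset g _
  have hkcont : Continuous k := continuous_fderiv_apply_self_add_smul hg _
  have hFc : HasCompactSupport F :=
    (hc.comp_left (g := fun v : G => ‖v‖ ^ p) (by simp [hp0.ne'])).mul_right
  have hF : ContDiff ℝ 1 F :=
    contDiff_mul_norm_rpow (hg.norm_rpow hp) (fun h => h0 (tsupport_norm_rpow_subset g hp0 h)) _
  have hFint : Integrable F := hF.continuous.integrable_of_hasCompactSupport hFc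
  have hKint : Integrable fun x => ‖k x‖ ^ p * ‖x‖ ^ (-a) :=
    integrable_norm_rpow_mul_norm_rpow hkcont (hc.of_isClosed_subset isClosed_closure hksupp)
      (fun h => h0 (hksupp h)) hp0 _
  have hF'int : Integrable fun x => fderiv ℝ F x x := by
    have := hF.continuous_fderiv one_ne_zero
    refine Continuous.integrable_of_hasCompactSupport (by fun_prop) ?_
    refine (hFc.fderiv ℝ).mono fun x hx => ?_
    contrapose! hx
    simp_all
  have hpt (x : EuclideanSpace ℝ (Fin n)) :
      c ^ (p - 1) * ‖fderiv ℝ F x x + (p * ((n : ℝ) - 1) + a) * F x‖ ≤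
        (p - 1) * c ^ p * F x + ‖k x‖ ^ p * ‖x‖ ^ (-a) := by
    rcases eq_or_ne x 0 with rfl | hx
    · have hg0 := image_eq_zero_of_notMem_tsupport h0
      simp [hFdef, hk, hg0, hp0.ne']
    have e1 : fderiv ℝ F x x + (p * ((n : ℝ) - 1) + a) * F x =
        p * ‖g x‖ ^ (p - 2) * inner ℝ (g x) (k x) * ‖x‖ ^ (-a) := by
      rw [fderiv_norm_rpow_mul_apply_self (hg.differentiable one_ne_zero x) hx hp]
      have : ‖g x‖ ^ p = ‖g x‖ ^ (p - 2) * ‖g x‖ ^ 2 := by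
        rcases eq_or_ne (g x) 0 with h | h
        · simp [h, hp0.ne']
        · rw [← Real.rpow_natCast, ← Real.rpow_add (norm_pos_iff.mpr h)]
          simp
      simp only [hk, hFdef, inner_add_right, inner_smul_right, real_inner_self_eq_norm_sq, this]
      ring
    have hW : 0 ≤ ‖x‖ ^ (-a) := by positivity
    have e2 : ‖g x‖ ^ (p - 1) = ‖g x‖ ^ (p - 2) * ‖g x‖ := by
      rcases eq_or_ne (g x) 0 with h | h
      · simp [h, (sub_pos.mpr hp).ne']
      · rw [← Real.rpow_add_one (norm_ne_zero_iff.mpr h)]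
        ring_nf
    calc c ^ (p - 1) * ‖fderiv ℝ F x x + (p * ((n : ℝ) - 1) + a) * F x‖
        = c ^ (p - 1) * (p * ‖g x‖ ^ (p - 2) * |inner ℝ (g x) (k x)| * ‖x‖ ^ (-a)) := by
          rw [e1, Real.norm_eq_abs, abs_mul, abs_mul, abs_of_nonneg hW,
            abs_of_nonneg (by positivity : 0 ≤ p * ‖g x‖ ^ (p - 2))]
      _ ≤ c ^ (p - 1) * (p * ‖g x‖ ^ (p - 2) * (‖g x‖ * ‖k x‖) * ‖x‖ ^ (-a)) := by
          gcongr
          exact abs_real_inner_le_norm _ _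
      _ = p * ((c * ‖g x‖) ^ (p - 1) * ‖k x‖) * ‖x‖ ^ (-a) := by
          rw [Real.mul_rpow hc0 (norm_nonneg _), e2]
          ring
      _ ≤ ((p - 1) * (c * ‖g x‖) ^ p + ‖k x‖ ^ p) * ‖x‖ ^ (-a) := by
          gcongr
          exact young_rpow_sub_one (by positivity) (norm_nonneg _) hp
      _ = _ := by
          rw [Real.mul_rpow hc0 (norm_nonneg _)]
          simp only [hFdef]
          ring
  have hI : 0 ≤ ∫ x, F x := integral_nonneg fun x => by positivity
  have key : c ^ (p - 1) * ‖∫ x, (fderiv ℝ F x x + (p * ((n : ℝ) - 1) + a) * F x)‖ ≤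
      (p - 1) * c ^ p * (∫ x, F x) + ∫ x, ‖k x‖ ^ p * ‖x‖ ^ (-a) := by
    calc _ ≤ c ^ (p - 1) * ∫ x, ‖fderiv ℝ F x x + (p * ((n : ℝ) - 1) + a) * F x‖ := by
          gcongr
          exact norm_integral_le_integral_norm _
      _ = ∫ x, c ^ (p - 1) * ‖fderiv ℝ F x x + (p * ((n : ℝ) - 1) + a) * F x‖ := by
          rw [integral_const_mul]
      _ ≤ ∫ x, ((p - 1) * c ^ p * F x + ‖k x‖ ^ p * ‖x‖ ^ (-a)) :=
          integral_mono ((hF'int.add (hFint.const_mul _)).norm.const_mul _)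
            ((hFint.const_mul _).add hKint) hpt
      _ = _ := by
          rw [integral_add (hFint.const_mul _) hKint, integral_const_mul]
  rw [integral_add hF'int (hFint.const_mul _), integral_const_mul,
    integral_fderiv_apply_self hF hFc, ← add_mul, norm_mul, Real.norm_of_nonneg hI,
    Real.norm_eq_abs] at key
  have hcp : |-(n : ℝ) + (p * ((n : ℝ) - 1) + a)| = p * c := by
    rw [hcdef, abs_div, abs_of_pos hp0, mul_div_cancel₀ _ hp0.ne']
    congr 1
    ring
  have hcpow : c ^ (p - 1) * c = c ^ p := by
    rcases hc0.eq_or_lt with h | h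
    · rw [← h, Real.zero_rpow hp0.ne', mul_zero]
    · rw [← Real.rpow_add_one h.ne', sub_add_cancel]
  have e3 : c ^ (p - 1) * (p * c * ∫ x, F x) = p * (c ^ p * ∫ x, F x) := by
    rw [← hcpow]
    ring
  rw [hcp, e3] at key
  linarith

theorem abs_rpow_mul_integral_norm_rpow_le {n : ℕ} {G : Type*} [NormedAddCommGroup G]
    [InnerProductSpace ℝ G] {g : EuclideanSpace ℝ (Fin n) → G} (hg : ContDiff ℝ 1 g)
    (hc : HasCompactSupport g) (h0 : (0 : EuclideanSpace ℝ (Fin n)) ∉ tsupport g)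
    {p : ℝ} (hp : 1 ≤ p) (a : ℝ) :
    |((n : ℝ) * (p - 1) + a - p) / p| ^ p * (∫ x, ‖g x‖ ^ p * ‖x‖ ^ (-a)) ≤
      ∫ x, ‖fderiv ℝ g x x + ((n : ℝ) - 1) • g x‖ ^ p * ‖x‖ ^ (-a) := by
  rcases hp.eq_or_lt with rfl | hp
  swap
  · exact abs_rpow_mul_integral_norm_rpow_le_of_one_lt hg hc h0 hp a
  have hk := tsupport_fderiv_apply_self_add_smul_subset g ((n : ℝ) - 1)
  have hcoef : ContinuousAt (fun q : ℝ => |((n : ℝ) * (q - 1) + a - q) / q| ^ q) 1 := by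
    refine ContinuousAt.rpow (ContinuousAt.abs (ContinuousAt.div ?_ continuousAt_id one_ne_zero))
      continuousAt_id (Or.inr one_pos)
    fun_prop
  exact le_of_tendsto_of_tendsto
    ((hcoef.tendsto.mono_left nhdsWithin_le_nhds).mul
      (tendsto_integral_norm_rpow_mul_norm_rpow hg.continuous hc h0 (-a)))
    (tendsto_integral_norm_rpow_mul_norm_rpow (continuous_fderiv_apply_self_add_smul hg _)
      (hc.of_isClosed_subset isClosed_closure hk) (fun h => h0 (hk h)) (-a))
    (eventually_mem_nhdsWithin.mono fun p hp =>
      abs_rpow_mul_integral_norm_rpow_le_of_one_lt hg hc h0 hp a)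

theorem tsupport_radDeriv_subset {n : ℕ} (f : EuclideanSpace ℝ (Fin n) → ℂ) :
    tsupport (radDeriv f) ⊆ tsupport f := by
  refine closure_minimal (fun x hx => ?_) isClosed_closure
  refine support_fderiv_subset ℝ (fun h => hx ?_)
  simp [radDeriv, h]

theorem contDiff_radDeriv {n : ℕ} {f : EuclideanSpace ℝ (Fin n) → ℂ} (hf : ContDiff ℝ 2 f)
    (h0 : (0 : EuclideanSpace ℝ (Fin n)) ∉ tsupport f) : ContDiff ℝ 1 (radDeriv f) := by
  refine contDiff_iff_contDiffAt.mpr fun x => ?_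
  by_cases hx : x ∈ tsupport f
  · have hx0 : x ≠ 0 := by
      rintro rfl
      exact h0 hx
    have h1 : ContDiff ℝ 1 (fderiv ℝ f) := hf.fderiv_right (by norm_num)
    exact h1.contDiffAt.clm_apply
      (((contDiffAt_norm ℝ hx0).inv (norm_ne_zero_iff.mpr hx0)).smul contDiffAt_id)
  · refine contDiffAt_const (c := 0) |>.congr_of_eventuallyEq ?_
    exact notMem_tsupport_iff_eventuallyEq.mp fun h => hx (tsupport_radDeriv_subset f h)

theorem norm_radDeriv_add_rpow_div {n : ℕ} (g : EuclideanSpace ℝ (Fin n) → ℂ) (hg : g 0 = 0)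
    (x : EuclideanSpace ℝ (Fin n)) {p : ℝ} (hp : 0 < p) (a : ℝ) :
    ‖radDeriv g x + ((((n : ℝ) - 1) / ‖x‖ : ℝ) : ℂ) * g x‖ ^ p / ‖x‖ ^ (a - p) =
      ‖fderiv ℝ g x x + ((n : ℝ) - 1) • g x‖ ^ p * ‖x‖ ^ (-a) := by
  rcases eq_or_ne x 0 with rfl | hx
  · simp [radDeriv, hg, hp.ne']
  have hx' : 0 < ‖x‖ := norm_pos_iff.mpr hx
  have h : fderiv ℝ g x x + ((n : ℝ) - 1) • g x =
      ‖x‖ • (radDeriv g x + ((((n : ℝ) - 1) / ‖x‖ : ℝ) : ℂ) * g x) := by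
    rw [radDeriv, map_smul, ← Complex.real_smul, smul_add, smul_smul, smul_smul,
      mul_inv_cancel₀ hx'.ne', one_smul, mul_div_cancel₀ _ hx'.ne']
  rw [h, norm_smul, norm_norm, Real.mul_rpow hx'.le (norm_nonneg _), Real.rpow_sub hx',
    Real.rpow_neg hx'.le]
  field_simp

theorem Lp_hardy_radial_laplacian {n : ℕ} (hn : 1 ≤ n) {R : ℝ} (hR : 0 < R)
    {p a : ℝ} (hp : 1 ≤ p)
    (f : EuclideanSpace ℝ (Fin n) → ℂ)
    (hf : ContDiff ℝ 2 f) (hcomp : HasCompactSupport f)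
    (hsupp : tsupport f ⊆ ball (0 : EuclideanSpace ℝ (Fin n)) R \ {0}) :
    |((n : ℝ) * (p - 1) + a - p) / p| ^ p *
      (∫ x in ball (0 : EuclideanSpace ℝ (Fin n)) R,
        ‖radDeriv f x‖ ^ p / ‖x‖ ^ a) ≤
    ∫ x in ball (0 : EuclideanSpace ℝ (Fin n)) R,
        ‖radDeriv (radDeriv f) x + ((((n : ℝ) - 1) / ‖x‖ : ℝ) : ℂ) * radDeriv f x‖ ^ p /
          ‖x‖ ^ (a - p) := by
  have h0 : (0 : EuclideanSpace ℝ (Fin n)) ∉ tsupport f := fun h => (hsupp h).2 rfl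
  have hp0 : 0 < p := one_pos.trans_le hp
  have hsub := tsupport_radDeriv_subset f
  have hzero {x : EuclideanSpace ℝ (Fin n)} (hx : x ∉ tsupport f) : radDeriv f x = 0 :=
    image_eq_zero_of_notMem_tsupport fun h => hx (hsub h)
  have hball {x : EuclideanSpace ℝ (Fin n)} (hx : x ∉ ball (0 : EuclideanSpace ℝ (Fin n)) R) :
      x ∉ tsupport f := fun h => hx (hsupp h).1
  rw [setIntegral_eq_integral_of_forall_compl_eq_zero,
    setIntegral_eq_integral_of_forall_compl_eq_zero]
  · simp_rw [norm_radDeriv_add_rpow_div (radDeriv f) (hzero h0) _ hp0, div_eq_mul_inv (_ ^ p),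
      ← Real.rpow_neg (norm_nonneg _)]
    exact abs_rpow_mul_integral_norm_rpow_le (contDiff_radDeriv hf h0)
      (hcomp.of_isClosed_subset isClosed_closure hsub) (fun h => h0 (hsub h)) hp a
  · intro x hx
    have h1 := hzero (hball hx)
    have h2 : radDeriv (radDeriv f) x = 0 := image_eq_zero_of_notMem_tsupport fun h =>
      hball hx (hsub (tsupport_radDeriv_subset _ h))
    simp [h1, h2, hp0.ne']
  · intro x hx
    simp [hzero (hball hx), hp0.ne']
end
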